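/- Let n ≥ 1, let M = ℝ^{2n-2} × (−1,1) × ℝ (an open subset of ℝ^{2n}, with (−1,1) the x_n-coordinate and ℝ the y_n-coordinate), and let R_1 = {0}^{2n-2} × [0,1) × {0}. There exists a smooth function F : M → ℝ such that, writing (S(z), T(z)) for the domain of the maximal integral curve of the Hamiltonian vector field X_F through z: (i) every forward trajectory of the flow of X_F starting in R_1 stays in R_1 as long as it is defined; (ii) T(z) > 1 for every z ∈ M ∖ R_1; (iii) T(z) ≤ 1 for every z ∈ R_1; (iv) S(z) < −1 for every z ∈ M. -/

import Mathlib

open Set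

noncomputable section

/-- `ℝ^{2n}` presented as `(p, xₙ, yₙ)` with `p = (x₁,y₁,…,x_{n-1},y_{n-1}) ∈ ℝ^{2(n-1)}`;
here `m = n - 1`, so `n ≥ 1` corresponds to arbitrary `m : ℕ`. -/
abbrev EE (m : ℕ) := ((Fin m → ℝ) × (Fin m → ℝ)) × ℝ × ℝ

/-- The standard symplectic form on `ℝ^{2m}`. -/
def wB (m : ℕ) (u v : (Fin m → ℝ) × (Fin m → ℝ)) : ℝ :=
  ∑ i, (u.1 i * v.2 i - u.2 i * v.1 i)

/-- The standard symplectic form `ω_can` on `ℝ^{2n} = ℝ^{2m} × ℝ × ℝ`. -/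
def wcan (m : ℕ) (u v : EE m) : ℝ :=
  wB m u.1 v.1 + (u.2.1 * v.2.2 - u.2.2 * v.2.1)

/-- `M = ℝ^{2n-2} × (-1,1) × ℝ`. -/
def Mset (m : ℕ) : Set (EE m) := {z | z.2.1 ∈ Ioo (-1 : ℝ) 1}

/-- `R₁ = {0}^{2n-2} × [0,1) × {0}`. -/
def R1 (m : ℕ) : Set (EE m) := {z | z.1 = 0 ∧ z.2.1 ∈ Ico (0 : ℝ) 1 ∧ z.2.2 = 0}

/-- A bounded globally Lipschitz vector field has integral curves on `(-2, 2)`. -/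
theorem LipschitzWith.exists_integralCurve {E : Type*} [NormedAddCommGroup E] [NormedSpace ℝ E]
    [CompleteSpace E] {f : E → E} {K L : NNReal} (hf : LipschitzWith K f)
    (hL : ∀ x, ‖f x‖ ≤ L) (z : E) :
    ∃ γ : ℝ → E, γ 0 = z ∧ ∀ t ∈ Ioo (-2 : ℝ) 2, HasDerivAt γ (f (γ t)) t := by
  have h0 : (0 : ℝ) ∈ Icc (-2 : ℝ) 2 := by norm_num
  have hpl : IsPicardLindelof (fun _ ↦ f) (⟨0, h0⟩ : Icc (-2 : ℝ) 2) z (L * 2) 0 L K :=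
    .of_time_independent (fun x _ ↦ hL x) hf.lipschitzOnWith (by simp)
  obtain ⟨γ, hγ0, hγ⟩ := hpl.exists_eq_forall_mem_Icc_hasDerivWithinAt₀
  exact ⟨γ, hγ0, fun t ht ↦ (hγ t (Ioo_subset_Icc_self ht)).hasDerivAt (Icc_mem_nhds ht.1 ht.2)⟩

/-- A `C¹` vector field on an open set `U` agrees on a given compact subset of `U` with a bounded
Lipschitz field on the whole space which is everywhere a multiple of it. -/
theorem exists_lipschitzWith_smul_eqOn {E : Type*} [NormedAddCommGroup E] [NormedSpace ℝ E]
    [FiniteDimensional ℝ E] {U N : Set E} {X : E → E} (hU : IsOpen U) (hX : ContDiffOn ℝ 1 X U)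
    (hN : IsCompact N) (hNU : N ⊆ U) :
    ∃ (χ : E → ℝ) (K L : NNReal), LipschitzWith K (fun x ↦ χ x • X x) ∧
      (∀ x, ‖χ x • X x‖ ≤ L) ∧ ∀ x ∈ N, χ x = 1 := by
  obtain ⟨N', hN', hNN', hN'U⟩ := exists_compact_between hN hU hNU
  obtain ⟨χ, hχ0, hχ1, -⟩ := exists_contMDiffMap_zero_one_of_isClosed (n := 1)
    (modelWithCornersSelf ℝ E) (isOpen_interior (s := N')).isClosed_compl hN.isClosed
    (disjoint_left.2 fun x hx hxN ↦ hx (hNN' hxN))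
  have hχ : ContDiff ℝ 1 χ := χ.contMDiff.contDiff
  have hzero : ∀ x ∉ N', χ x = 0 := fun x hx ↦ hχ0 fun h ↦ hx (interior_subset h)
  have hsupp : HasCompactSupport (fun x ↦ χ x • X x) :=
    HasCompactSupport.intro hN' fun x hx ↦ by simp [hzero x hx]
  have hdiff : ContDiff ℝ 1 (fun x ↦ χ x • X x) := by
    rw [contDiff_iff_contDiffAt]
    intro x
    by_cases hx : x ∈ U
    · exact hχ.contDiffAt.smul (hX.contDiffAt (hU.mem_nhds hx))
    · refine contDiffAt_const (c := (0 : E)) |>.congr_of_eventuallyEq ?_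
      filter_upwards [hN'.isClosed.isOpen_compl.mem_nhds fun h ↦ hx (hN'U h)] with y hy
      simp [hzero y hy]
  obtain ⟨K, hK⟩ := hdiff.lipschitzWith_of_hasCompactSupport hsupp one_ne_zero
  obtain ⟨L, hL⟩ := hsupp.exists_bound_of_continuous hdiff.continuous
  exact ⟨χ, K, L.toNNReal, hK, fun x ↦ (hL x).trans (Real.le_coe_toNNReal L), fun x hx ↦ hχ1 hx⟩

/-- If `F` is a first integral of `X` on `U` and the level set of `F` through `z` is
contained in a compact subset of `U`, then the integral curve of `X` through `z` exists on
`(-2, 2)`. -/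
theorem exists_integralCurve_of_levelSet_subset_isCompact {E : Type*} [NormedAddCommGroup E]
    [NormedSpace ℝ E] [FiniteDimensional ℝ E] {U N : Set E} {X : E → E} {F : E → ℝ}
    (hU : IsOpen U) (hX : ContDiffOn ℝ 1 X U) (hF : DifferentiableOn ℝ F U)
    (hFX : ∀ z ∈ U, fderiv ℝ F z (X z) = 0) (hN : IsCompact N) (hNU : N ⊆ U) {z : E} (hz : z ∈ U)
    (hlev : ∀ w ∈ U, F w = F z → w ∈ N) :
    ∃ γ : ℝ → E, γ 0 = z ∧ ∀ t ∈ Ioo (-2 : ℝ) 2, γ t ∈ U ∧ HasDerivAt γ (X (γ t)) t := by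
  have : CompleteSpace E := FiniteDimensional.complete ℝ E
  obtain ⟨χ, K, L, hK, hL, hχ⟩ := exists_lipschitzWith_smul_eqOn hU hX hN hNU
  obtain ⟨γ, hγ0, hγ⟩ := hK.exists_integralCurve hL z
  have hFγ : ∀ t ∈ Ioo (-2 : ℝ) 2, γ t ∈ U → HasDerivAt (fun s ↦ F (γ s)) 0 t := by
    intro t ht hU'
    have h := ((hF.differentiableAt (hU.mem_nhds hU')).hasFDerivAt).comp_hasDerivAt t (hγ t ht)
    simpa [hFX _ hU'] using! h
  let S : Set ℝ := {t | t ∈ Ioo (-2 : ℝ) 2 ∧ γ t ∈ U ∧ F (γ t) = F z}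
  have hSN : ∀ t ∈ S, γ t ∈ N := fun t ht ↦ hlev _ ht.2.1 ht.2.2
  have hSo : IsOpen S := by
    rw [Metric.isOpen_iff]
    intro t ht
    have hev : ∀ᶠ s in nhds t, s ∈ Ioo (-2 : ℝ) 2 ∧ γ s ∈ U :=
      (isOpen_Ioo.eventually_mem ht.1).and
        ((hγ t ht.1).continuousAt.eventually (hU.mem_nhds ht.2.1))
    obtain ⟨ε, hε, hball⟩ := Metric.eventually_nhds_iff_ball.1 hev
    refine ⟨ε, hε, fun s hs ↦ ⟨(hball s hs).1, (hball s hs).2, ?_⟩⟩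
    have hd : ∀ r ∈ Metric.ball t ε, HasDerivAt (fun s ↦ F (γ s)) 0 r :=
      fun r hr ↦ hFγ r (hball r hr).1 (hball r hr).2
    rw [← ht.2.2]
    exact Metric.isOpen_ball.is_const_of_deriv_eq_zero (convex_ball t ε).isPreconnected
      (fun r hr ↦ (hd r hr).differentiableAt.differentiableWithinAt)
      (fun r hr ↦ (hd r hr).deriv) hs (Metric.mem_ball_self hε)
  have h0 : (0 : ℝ) ∈ Ioo (-2 : ℝ) 2 := by norm_num
  have hsub : Ioo (-2 : ℝ) 2 ⊆ S := by
    refine isPreconnected_Ioo.subset_of_closure_inter_subset hSo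
      ⟨0, h0, h0, by rwa [hγ0], by rw [hγ0]⟩ ?_
    rintro t ⟨htc, ht⟩
    have hc := (hγ t ht).continuousAt
    have htU : γ t ∈ U :=
      hNU (hN.isClosed.closure_subset (hc.continuousWithinAt.mem_closure htc hSN))
    refine ⟨ht, htU, ?_⟩
    have hm := (hFγ t ht htU).continuousAt.continuousWithinAt.mem_closure htc
      (t := {F z}) fun s hs ↦ hs.2.2
    simpa using hm
  refine ⟨γ, hγ0, fun t ht ↦ ⟨(hsub ht).2.1, ?_⟩⟩
  simpa [hχ _ (hSN t (hsub ht))] using hγ t ht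

theorem eq_of_hasDerivAt_zero_Icc {E : Type*} [NormedAddCommGroup E] [NormedSpace ℝ E]
    {f : ℝ → E} {T : ℝ} (hf : ∀ t ∈ Icc 0 T, HasDerivAt f 0 t) : ∀ t ∈ Icc 0 T, f t = f 0 :=
  constant_of_has_deriv_right_zero (fun t ht ↦ (hf t ht).continuousAt.continuousWithinAt)
    fun t ht ↦ (hf t (Ico_subset_Icc_self ht)).hasDerivWithinAt

/-- The squared Euclidean norm on `ℝ^{2m}`. -/
def normSqB {m : ℕ} (p : (Fin m → ℝ) × (Fin m → ℝ)) : ℝ := ∑ i, (p.1 i ^ 2 + p.2 i ^ 2)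

/-- The denominator `(1 - xₙ) + yₙ² + |p|²`. -/
def den {m : ℕ} (z : EE m) : ℝ := 1 - z.2.1 + z.2.2 ^ 2 + normSqB z.1

/-- The Hamiltonian `log 2 · yₙ (1 - xₙ²) / ((1 - xₙ) + yₙ² + |p|²)`. -/
def ham {m : ℕ} (z : EE m) : ℝ := Real.log 2 * z.2.2 * (1 - z.2.1 ^ 2) / den z

/-- The angular speed of the `p`-component of `hamField`. -/
def angularSpeed {m : ℕ} (z : EE m) : ℝ :=
  -(2 * Real.log 2 * z.2.2 * (1 - z.2.1 ^ 2)) / den z ^ 2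

/-- The Hamiltonian vector field of `ham`. -/
def hamField {m : ℕ} (z : EE m) : EE m :=
  ((angularSpeed z • z.1.2, -angularSpeed z • z.1.1),
    Real.log 2 * (1 - z.2.1 ^ 2) * (den z - 2 * z.2.2 ^ 2) / den z ^ 2,
    Real.log 2 * z.2.2 * (2 * z.2.1 * den z - (1 - z.2.1 ^ 2)) / den z ^ 2)

section

variable {m : ℕ}

theorem normSqB_nonneg (p : (Fin m → ℝ) × (Fin m → ℝ)) : 0 ≤ normSqB p :=
  Finset.sum_nonneg fun _ _ ↦ by positivity

theorem normSqB_pos {p : (Fin m → ℝ) × (Fin m → ℝ)} (hp : p ≠ 0) : 0 < normSqB p := by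
  refine (normSqB_nonneg p).lt_of_ne' fun h ↦ hp ?_
  rw [normSqB, Finset.sum_eq_zero_iff_of_nonneg fun _ _ ↦ by positivity] at h
  ext i
  · have := h i (Finset.mem_univ i)
    simp only [Prod.fst_zero, Pi.zero_apply]
    nlinarith [sq_nonneg (p.1 i), sq_nonneg (p.2 i)]
  · have := h i (Finset.mem_univ i)
    simp only [Prod.snd_zero, Pi.zero_apply]
    nlinarith [sq_nonneg (p.1 i), sq_nonneg (p.2 i)]

theorem norm_le_of_normSqB_le {p : (Fin m → ℝ) × (Fin m → ℝ)} {B : ℝ} (hB : 0 ≤ B)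
    (h : normSqB p ≤ B ^ 2) : ‖p‖ ≤ B := by
  have hi : ∀ i, p.1 i ^ 2 + p.2 i ^ 2 ≤ B ^ 2 := fun i ↦
    (Finset.single_le_sum (f := fun i ↦ p.1 i ^ 2 + p.2 i ^ 2) (fun _ _ ↦ by positivity)
      (Finset.mem_univ i)).trans h
  rw [norm_prod_le_iff, pi_norm_le_iff_of_nonneg hB, pi_norm_le_iff_of_nonneg hB]
  exact ⟨fun i ↦ abs_le_of_sq_le_sq (by nlinarith [hi i, sq_nonneg (p.2 i)]) hB,
    fun i ↦ abs_le_of_sq_le_sq (by nlinarith [hi i, sq_nonneg (p.1 i)]) hB⟩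

theorem den_pos {z : EE m} (hz : z ∈ Mset m) : 0 < den z := by
  have h1 : z.2.1 < 1 := hz.2
  have := normSqB_nonneg z.1
  unfold den
  nlinarith [sq_nonneg z.2.2]

theorem isOpen_Mset : IsOpen (Mset m) := isOpen_Ioo.preimage (by fun_prop)

theorem one_sub_sq_pos {z : EE m} (hz : z ∈ Mset m) : 0 < 1 - z.2.1 ^ 2 := by
  nlinarith [hz.1, hz.2]

theorem contDiff_normSqB {n : WithTop ℕ∞} :
    ContDiff ℝ n (normSqB : (Fin m → ℝ) × (Fin m → ℝ) → ℝ) := by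
  unfold normSqB
  fun_prop

theorem contDiff_den {n : WithTop ℕ∞} : ContDiff ℝ n (den : EE m → ℝ) := by
  have := contDiff_normSqB (m := m) (n := n)
  unfold den
  fun_prop

theorem contDiffOn_ham {n : WithTop ℕ∞} : ContDiffOn ℝ n (ham : EE m → ℝ) (Mset m) := by
  have := contDiff_den (m := m) (n := n)
  unfold ham
  exact ContDiffOn.div (by fun_prop) this.contDiffOn fun z hz ↦ (den_pos hz).ne'

theorem contDiffOn_hamField {n : WithTop ℕ∞} :
    ContDiffOn ℝ n (hamField : EE m → EE m) (Mset m) := by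
  have hd := contDiff_den (m := m) (n := n)
  have h2 : ContDiffOn ℝ n (fun z : EE m ↦ den z ^ 2) (Mset m) := by fun_prop
  have h0 : ∀ z ∈ Mset m, den z ^ 2 ≠ 0 := fun z hz ↦ (pow_pos (den_pos hz) 2).ne'
  have ha : ContDiffOn ℝ n (angularSpeed : EE m → ℝ) (Mset m) := by
    unfold angularSpeed
    exact ContDiffOn.div (by fun_prop) h2 h0
  unfold hamField
  refine ContDiffOn.prodMk (ContDiffOn.prodMk ?_ ?_) (ContDiffOn.prodMk ?_ ?_)
  · exact ha.smul (by fun_prop)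
  · exact ha.neg.smul (by fun_prop)
  · exact ContDiffOn.div (by fun_prop) h2 h0
  · exact ContDiffOn.div (by fun_prop) h2 h0

theorem hasDerivAt_normSqB_line (p w : (Fin m → ℝ) × (Fin m → ℝ)) :
    HasDerivAt (fun t : ℝ ↦ normSqB (p + t • w))
      (2 * ∑ i, (p.1 i * w.1 i + p.2 i * w.2 i)) 0 := by
  have h : ∀ a b : ℝ, HasDerivAt (fun t : ℝ ↦ (a + t * b) ^ 2) (2 * (a * b)) 0 := fun a b ↦ by
    convert! (((hasDerivAt_id (0 : ℝ)).mul_const b).const_add a).pow 2 using 1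
    simp
    ring
  unfold normSqB
  rw [Finset.mul_sum]
  refine HasDerivAt.fun_sum fun i _ ↦ ?_
  convert! (h (p.1 i) (w.1 i)).add (h (p.2 i) (w.2 i)) using 1
  ring

theorem wcan_hamField {z : EE m} (hz : z ∈ Mset m) (w : EE m) :
    wcan m (hamField z) w = fderiv ℝ ham z w := by
  have hd := (den_pos hz).ne'
  have hdiff : DifferentiableAt ℝ ham z :=
    (contDiffOn_ham (n := 1)).differentiableOn one_ne_zero |>.differentiableAt
      (isOpen_Mset.mem_nhds hz)
  have hx : HasDerivAt (fun t : ℝ ↦ z.2.1 + t * w.2.1) w.2.1 0 := by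
    simpa using ((hasDerivAt_id (0 : ℝ)).mul_const w.2.1).const_add z.2.1
  have hy : HasDerivAt (fun t : ℝ ↦ z.2.2 + t * w.2.2) w.2.2 0 := by
    simpa using ((hasDerivAt_id (0 : ℝ)).mul_const w.2.2).const_add z.2.2
  have hden := ((hx.const_sub 1).add (hy.pow 2)).add (hasDerivAt_normSqB_line z.1 w.1)
  have hnum := (hy.const_mul (Real.log 2)).mul ((hx.pow 2).const_sub 1)
  have hline := hnum.div hden (by simpa [den] using hd)
  have hline' : HasLineDerivAt ℝ ham (wcan m (hamField z) w) z w := by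
    unfold HasLineDerivAt
    convert! hline using 1
    have hB : wB m (hamField z).1 w.1 =
        angularSpeed z * ∑ i, (z.1.1 i * w.1.1 i + z.1.2 i * w.1.2 i) := by
      simp only [wB, hamField, Finset.mul_sum, Pi.smul_apply, smul_eq_mul]
      exact Finset.sum_congr rfl fun i _ ↦ by ring
    rw [wcan, hB]
    simp [hamField, angularSpeed]
    rw [show 1 - z.2.1 + z.2.2 ^ 2 + normSqB z.1 = den z from rfl]
    field_simp
    ring
  rw [← hline'.lineDeriv, hdiff.lineDeriv_eq_fderiv]

theorem wcan_self (u : EE m) : wcan m u u = 0 := by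
  simp [wcan, wB, mul_comm]

theorem fderiv_ham_hamField {z : EE m} (hz : z ∈ Mset m) : fderiv ℝ ham z (hamField z) = 0 := by
  rw [← wcan_hamField hz, wcan_self]

/-- A point of `M` where `ham` takes the value `a ≠ 0` lies in a compact box in `M`. -/
theorem mem_box_of_ham_eq {z : EE m} (hz : z ∈ Mset m) {a : ℝ} (ha : a ≠ 0) (h : ham z = a) :
    z ∈ Metric.closedBall (0 : (Fin m → ℝ) × (Fin m → ℝ)) (Real.log 2 / |a|) ×ˢ
      Icc (-1 + |a| ^ 2 / (4 * Real.log 2 ^ 2)) (1 - |a| ^ 2 / (4 * Real.log 2 ^ 2)) ×ˢ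
      Icc (-(Real.log 2 / |a|)) (Real.log 2 / |a|) := by
  have hc : 0 < Real.log 2 := Real.log_pos one_lt_two
  have hd := den_pos hz
  have hx := one_sub_sq_pos hz
  have hA : 0 < |a| := abs_pos.2 ha
  have hq := normSqB_nonneg z.1
  have h1 : -1 < z.2.1 := hz.1
  have h2 : z.2.1 < 1 := hz.2
  have hmul : |a| * den z = Real.log 2 * |z.2.2| * (1 - z.2.1 ^ 2) := by
    rw [ham, div_eq_iff hd.ne'] at h
    have := congrArg abs h
    simp only [abs_mul, abs_of_pos hc, abs_of_pos hx, abs_of_pos hd] at this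
    exact this.symm
  have hden : den z = 1 - z.2.1 + |z.2.2| ^ 2 + normSqB z.1 := by rw [sq_abs]; rfl
  have hy0 : 0 < |z.2.2| := by
    refine (abs_nonneg _).lt_of_ne' fun h0 ↦ ?_
    rw [h0] at hmul
    nlinarith [mul_pos hA hd]
  generalize hYdef : |z.2.2| = Y at *
  generalize |a| = A at *
  generalize Real.log 2 = c at *
  have hcY : 0 < c * Y := mul_pos hc hy0
  have hle : A * den z ≤ c * Y := by
    rw [hmul]
    nlinarith [mul_nonneg hcY.le (sq_nonneg z.2.1)]
  have hAY : A * Y ≤ c := by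
    refine le_of_mul_le_mul_right ?_ hy0
    nlinarith [mul_nonneg hA.le hq, mul_pos hA (sub_pos.2 h2)]
  have hAY' : A * Y ≤ c * (1 - z.2.1 ^ 2) := by
    refine le_of_mul_le_mul_right ?_ hy0
    nlinarith [mul_nonneg hA.le hq, mul_pos hA (sub_pos.2 h2)]
  have hAx : A ≤ c * Y * (1 + z.2.1) := by
    refine le_of_mul_le_mul_right ?_ (sub_pos.2 h2)
    nlinarith [mul_nonneg hA.le hq, mul_nonneg hA.le (sq_nonneg Y)]
  have hB : Y ≤ c / A := by rw [le_div_iff₀ hA]; linarith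
  have hqB : normSqB z.1 ≤ (c / A) ^ 2 := by
    have : normSqB z.1 ≤ c * Y / A := by
      rw [le_div_iff₀ hA]
      nlinarith [mul_nonneg hA.le (sq_nonneg Y), mul_pos hA (sub_pos.2 h2)]
    calc normSqB z.1 ≤ c * Y / A := this
      _ = c / A * Y := by ring
      _ ≤ c / A * (c / A) := by gcongr
      _ = (c / A) ^ 2 := by ring
  have hsq : A ^ 2 ≤ c * (A * Y) * (1 + z.2.1) := by nlinarith
  have hl : A ^ 2 / (4 * c ^ 2) ≤ 1 + z.2.1 := by
    rw [div_le_iff₀ (by positivity)]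
    have : c * (A * Y) * (1 + z.2.1) ≤ c * c * (1 + z.2.1) := by
      gcongr
      linarith
    nlinarith [mul_pos (mul_pos hc hc) (neg_lt_iff_pos_add'.1 h1)]
  have hr : A ^ 2 / (4 * c ^ 2) ≤ 1 - z.2.1 := by
    rw [div_le_iff₀ (by positivity)]
    have h3 : c * (A * Y) * (1 + z.2.1) ≤ c * (c * (1 - z.2.1 ^ 2)) * (1 + z.2.1) := by
      gcongr
      linarith
    have h4 : (1 + z.2.1) ^ 2 * (1 - z.2.1) ≤ 4 * (1 - z.2.1) := by
      have := sub_pos.2 h2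
      gcongr
      nlinarith
    nlinarith [mul_le_mul_of_nonneg_left h4 (mul_pos hc hc).le]
  refine ⟨?_, ⟨by linarith, by linarith⟩, abs_le.1 (hYdef.trans_le hB)⟩
  rw [mem_closedBall_zero_iff]
  exact norm_le_of_normSqB_le (by positivity) hqB

theorem exists_integralCurve_of_ne_zero {z : EE m} (hz : z ∈ Mset m) (hy : z.2.2 ≠ 0) :
    ∃ γ : ℝ → EE m, γ 0 = z ∧
      ∀ t ∈ Ioo (-2 : ℝ) 2, γ t ∈ Mset m ∧ HasDerivAt γ (hamField (γ t)) t := by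
  have hc : 0 < Real.log 2 := Real.log_pos one_lt_two
  have ha : ham z ≠ 0 :=
    div_ne_zero (mul_ne_zero (mul_ne_zero hc.ne' hy) (one_sub_sq_pos hz).ne') (den_pos hz).ne'
  refine exists_integralCurve_of_levelSet_subset_isCompact isOpen_Mset contDiffOn_hamField
    (contDiffOn_ham.differentiableOn one_ne_zero) (fun _ ↦ fderiv_ham_hamField)
    ((isCompact_closedBall _ _).prod (isCompact_Icc.prod isCompact_Icc)) ?_ hz
    (fun w hw h ↦ mem_box_of_ham_eq hw ha h)
  rintro w ⟨-, hw, -⟩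
  have : 0 < |ham z| ^ 2 / (4 * Real.log 2 ^ 2) := by positivity
  exact ⟨by linarith [hw.1], by linarith [hw.2]⟩

theorem hasDerivAt_tanh (u : ℝ) : HasDerivAt Real.tanh (1 - Real.tanh u ^ 2) u := by
  have h := (Real.hasDerivAt_sinh u).div (Real.hasDerivAt_cosh u) (Real.cosh_pos u).ne'
  convert! h using 1
  · ext x
    exact Real.tanh_eq_sinh_div_cosh x
  · rw [Real.tanh_eq_sinh_div_cosh]
    field_simp [(Real.cosh_pos u).ne']

theorem hamField_of_eq_zero (p : (Fin m → ℝ) × (Fin m → ℝ)) {x : ℝ} (hx : x ∈ Ioo (-1 : ℝ) 1) :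
    hamField (p, x, 0) =
      ((0 : EE m).1, Real.log 2 * (1 - x ^ 2) / (1 - x + normSqB p), 0) := by
  have hd := den_pos (z := (p, x, 0)) hx
  have hden : den (p, x, (0 : ℝ)) = 1 - x + normSqB p := by simp [den]
  rw [hden] at hd
  have : angularSpeed (p, x, (0 : ℝ)) = 0 := by simp [angularSpeed]
  ext i
  · simp [hamField, this]
  · simp [hamField, this]
  · simp only [hamField, hden]
    field_simp
    simp
  · simp [hamField]

theorem hasDerivAt_slice (p : (Fin m → ℝ) × (Fin m → ℝ)) {x : ℝ → ℝ} {x' t : ℝ}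
    (hx : HasDerivAt x x' t) :
    HasDerivAt (fun s ↦ ((p, x s, 0) : EE m)) ((0 : EE m).1, x', 0) t :=
  (hasDerivAt_const t p).prodMk (hx.prodMk (hasDerivAt_const t 0))

theorem exists_integralCurve_slice {p : (Fin m → ℝ) × (Fin m → ℝ)} (hp : p ≠ 0) {x : ℝ}
    (hx : x ∈ Ioo (-1 : ℝ) 1) :
    ∃ γ : ℝ → EE m, γ 0 = (p, x, 0) ∧
      ∀ t ∈ Ioo (-2 : ℝ) 2, γ t ∈ Mset m ∧ HasDerivAt γ (hamField (γ t)) t := by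
  have hc : 0 < Real.log 2 := Real.log_pos one_lt_two
  have hq := normSqB_pos hp
  have hpos : ∀ u, normSqB p < 1 - Real.tanh u + normSqB p := fun u ↦ by
    linarith [Real.tanh_lt_one u]
  have hderiv : ∀ u, HasDerivAt (fun u ↦ Real.log 2 / (1 - Real.tanh u + normSqB p))
      (Real.log 2 * (1 - Real.tanh u ^ 2) / (1 - Real.tanh u + normSqB p) ^ 2) u := fun u ↦ by
    convert! (hasDerivAt_const u (Real.log 2)).div
      (((hasDerivAt_tanh u).const_sub 1).add_const (normSqB p)) (hq.trans (hpos u)).ne' using 1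
    ring
  have hlip : LipschitzWith (Real.log 2 / normSqB p ^ 2).toNNReal
      (fun u ↦ Real.log 2 / (1 - Real.tanh u + normSqB p)) := by
    refine lipschitzWith_of_nnnorm_deriv_le (fun u ↦ (hderiv u).differentiableAt) fun u ↦ ?_
    rw [(hderiv u).deriv, ← NNReal.coe_le_coe, coe_nnnorm, Real.coe_toNNReal _ (by positivity)]
    have h1 := Real.tanh_sq_lt_one u
    rw [Real.norm_of_nonneg (div_nonneg (mul_nonneg hc.le (by linarith)) (sq_nonneg _))]
    have h2 := hpos u
    gcongr
    nlinarith [sq_nonneg (Real.tanh u)]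
  have hbd : ∀ u, ‖Real.log 2 / (1 - Real.tanh u + normSqB p)‖ ≤
      (Real.log 2 / normSqB p).toNNReal := fun u ↦ by
    have h2 := hpos u
    rw [Real.coe_toNNReal _ (by positivity), Real.norm_of_nonneg (div_nonneg hc.le (by linarith))]
    gcongr
  obtain ⟨u, hu0, hu⟩ := hlip.exists_integralCurve hbd (Real.artanh x)
  refine ⟨fun t ↦ (p, Real.tanh (u t), 0), by simp [hu0, Real.tanh_artanh hx], fun t ht ↦ ?_⟩
  have hmem : Real.tanh (u t) ∈ Ioo (-1 : ℝ) 1 := ⟨Real.neg_one_lt_tanh _, Real.tanh_lt_one _⟩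
  refine ⟨hmem, ?_⟩
  rw [hamField_of_eq_zero p hmem]
  convert! hasDerivAt_slice p ((hasDerivAt_tanh (u t)).comp t (hu t ht)) using 3
  ring

theorem hamField_axis {x : ℝ} (hx : x ∈ Ioo (-1 : ℝ) 1) :
    hamField ((0, x, 0) : EE m) = ((0 : EE m).1, Real.log 2 * (1 + x), 0) := by
  have : (1 : ℝ) - x ≠ 0 := (sub_pos.2 hx.2).ne'
  rw [hamField_of_eq_zero 0 hx, show normSqB (0 : (Fin m → ℝ) × (Fin m → ℝ)) = 0 by
    simp [normSqB], add_zero]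
  congr 2
  field_simp
  ring

/-- The integral curve of `hamField` through `(0, x, 0)`. -/
def axisCurve (m : ℕ) (x t : ℝ) : EE m := (0, -1 + (1 + x) * Real.exp (Real.log 2 * t), 0)

theorem axisCurve_zero (x : ℝ) : axisCurve m x 0 = (0, x, 0) := by simp [axisCurve]

theorem hasDerivAt_axisCurve {x t : ℝ} (h : axisCurve m x t ∈ Mset m) :
    HasDerivAt (axisCurve m x) (hamField (axisCurve m x t)) t := by
  rw [show axisCurve m x t = (0, (axisCurve m x t).2.1, 0) from rfl, hamField_axis h]
  refine hasDerivAt_slice 0 ?_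
  have := ((((hasDerivAt_id t).const_mul (Real.log 2)).exp).const_mul (1 + x)).const_add (-1)
  convert! this using 1
  simp [axisCurve]
  ring

theorem exp_log_two_mul_le {t s : ℝ} (h : t ≤ s) :
    Real.exp (Real.log 2 * t) ≤ Real.exp (Real.log 2 * s) :=
  Real.exp_le_exp.2 (mul_le_mul_of_nonneg_left h (Real.log_pos one_lt_two).le)

theorem axisCurve_mem_Mset {x t : ℝ} (hx : -1 < x)
    (h : (1 + x) * Real.exp (Real.log 2 * t) < 2) : axisCurve m x t ∈ Mset m := by
  have : 0 < (1 + x) * Real.exp (Real.log 2 * t) :=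
    mul_pos (by linarith) (Real.exp_pos _)
  exact ⟨by simp only [axisCurve]; linarith, by simp only [axisCurve]; linarith⟩

/-- Integral curves of `hamField` in `M` starting on the `xₙ`-axis are the curves `axisCurve`. -/
theorem eq_axisCurve {γ : ℝ → EE m} {T x : ℝ} (h0 : γ 0 = (0, x, 0))
    (hγ : ∀ t ∈ Icc 0 T, γ t ∈ Mset m ∧ HasDerivAt γ (hamField (γ t)) t) :
    ∀ t ∈ Icc 0 T, γ t = axisCurve m x t := by
  have hc : 0 < Real.log 2 := Real.log_pos one_lt_two
  have hham : ∀ t ∈ Icc 0 T, ham (γ t) = 0 := by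
    intro t ht
    rw [eq_of_hasDerivAt_zero_Icc (f := fun s ↦ ham (γ s)) (fun s hs ↦ ?_) t ht]
    · simp [h0, ham]
    · obtain ⟨hM, hd⟩ := hγ s hs
      have hF := (contDiffOn_ham (n := 1)).differentiableOn one_ne_zero |>.differentiableAt
        (isOpen_Mset.mem_nhds hM)
      simpa [fderiv_ham_hamField hM] using! hF.hasFDerivAt.comp_hasDerivAt s hd
  have hy : ∀ t ∈ Icc 0 T, (γ t).2.2 = 0 := by
    intro t ht
    have hM := (hγ t ht).1
    simpa [ham, hc.ne', (den_pos hM).ne', (one_sub_sq_pos hM).ne'] using hham t ht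
  have hp : ∀ t ∈ Icc 0 T, (γ t).1 = 0 := by
    intro t ht
    rw [eq_of_hasDerivAt_zero_Icc (f := fun s ↦ (γ s).1) (fun s hs ↦ ?_) t ht]
    · simp [h0]
    · have hd : HasDerivAt (fun s ↦ (γ s).1) (hamField (γ s)).1 s :=
        (hasFDerivAt_fst (𝕜 := ℝ) (p := γ s)).comp_hasDerivAt s (hγ s hs).2
      convert! hd using 1
      simp [hamField, angularSpeed, hy s hs, Prod.zero_eq_mk]
  have heq : ∀ t ∈ Icc 0 T, γ t = (0, (γ t).2.1, 0) := fun t ht ↦ by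
    rw [← hp t ht, ← hy t ht]
  have hx : ∀ t ∈ Icc 0 T, (1 + (γ t).2.1) * Real.exp (-(Real.log 2 * t)) = 1 + x := by
    intro t ht
    rw [eq_of_hasDerivAt_zero_Icc
      (f := fun s ↦ (1 + (γ s).2.1) * Real.exp (-(Real.log 2 * s))) (fun s hs ↦ ?_) t ht]
    · simp [h0]
    · obtain ⟨hM, hd⟩ := hγ s hs
      have h1 : HasDerivAt (fun s ↦ (γ s).2.1) (hamField (γ s)).2.1 s :=
        ((hasFDerivAt_snd (𝕜 := ℝ) (p := γ s)).fst).comp_hasDerivAt s hd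
      rw [heq s hs, hamField_axis hM] at h1
      convert! (h1.const_add 1).mul ((hasDerivAt_id s).const_mul (Real.log 2)).neg.exp using 1
      simp
      ring
  intro t ht
  rw [heq t ht, axisCurve, ← hx t ht, mul_assoc, ← Real.exp_add]
  simp

end

/-- There is a smooth `F : M → ℝ` on `M = ℝ^{2n-2} × (-1,1) × ℝ`, with Hamiltonian
vector field `X = X_F` (characterized on `M` by `ω_can(X z, w) = dF_z w`), such that,
in terms of the maximal integral curves of `X_F` valued in `M`:
(i) forward trajectories starting in `R₁` stay in `R₁` as long as they are defined;
(ii) for `z ∈ M ∖ R₁` the forward escape time is `> 1`, i.e. a solution exists on `[0,1]`;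
(iii) for `z ∈ R₁` the forward escape time is `≤ 1`, i.e. no solution exists on `[0,1]`;
(iv) for every `z ∈ M` the backward escape time is `< -1`, i.e. a solution exists
on `[-1,0]`. -/
theorem exists_hamiltonian_excising_R1 (m : ℕ) :
    ∃ F : EE m → ℝ, ContDiffOn ℝ (⊤ : ℕ∞) F (Mset m) ∧
    ∃ X : EE m → EE m,
      (∀ z ∈ Mset m, ∀ w, wcan m (X z) w = fderiv ℝ F z w) ∧
      -- (i) forward invariance of R₁
      (∀ (γ : ℝ → EE m) (T : ℝ), 0 ≤ T → γ 0 ∈ R1 m →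
        (∀ t ∈ Icc 0 T, γ t ∈ Mset m ∧ HasDerivAt γ (X (γ t)) t) →
        ∀ t ∈ Icc 0 T, γ t ∈ R1 m) ∧
      -- (ii) T(z) > 1 for z ∈ M ∖ R₁
      (∀ z ∈ Mset m \ R1 m, ∃ γ : ℝ → EE m, γ 0 = z ∧
        ∀ t ∈ Icc (0:ℝ) 1, γ t ∈ Mset m ∧ HasDerivAt γ (X (γ t)) t) ∧
      -- (iii) T(z) ≤ 1 for z ∈ R₁
      (∀ z ∈ R1 m, ¬ ∃ γ : ℝ → EE m, γ 0 = z ∧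
        ∀ t ∈ Icc (0:ℝ) 1, γ t ∈ Mset m ∧ HasDerivAt γ (X (γ t)) t) ∧
      -- (iv) S(z) < -1 for all z ∈ M
      (∀ z ∈ Mset m, ∃ γ : ℝ → EE m, γ 0 = z ∧
        ∀ t ∈ Icc (-1 : ℝ) 0, γ t ∈ Mset m ∧ HasDerivAt γ (X (γ t)) t) := by
  have hexp1 : Real.exp (Real.log 2 * 1) = 2 := by rw [mul_one, Real.exp_log two_pos]
  have hR1 : ∀ z ∈ R1 m, z = (0, z.2.1, 0) := fun z hz ↦ by rw [← hz.1, ← hz.2.2]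
  refine ⟨ham, contDiffOn_ham, hamField, fun z hz w ↦ wcan_hamField hz w, ?_, ?_, ?_, ?_⟩
  · intro γ T _ h0 hγ t ht
    have heq := eq_axisCurve (hR1 _ h0) hγ t ht
    have hM := (hγ t ht).1
    have hx := h0.2.1.1
    rw [heq] at hM ⊢
    refine ⟨rfl, ⟨?_, hM.2⟩, rfl⟩
    have : 1 ≤ Real.exp (Real.log 2 * t) := by simpa using exp_log_two_mul_le ht.1
    simp only [axisCurve]
    nlinarith
  · rintro z ⟨hz, hzR⟩
    by_cases hy : z.2.2 = 0
    · by_cases hp : z.1 = 0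
      · have hx : z.2.1 < 0 := by
          by_contra! h
          exact hzR ⟨hp, ⟨h, hz.2⟩, hy⟩
        have h1 : -1 < z.2.1 := hz.1
        refine ⟨axisCurve m z.2.1, by rw [axisCurve_zero, ← hp, ← hy], fun t ht ↦ ?_⟩
        have hM : axisCurve m z.2.1 t ∈ Mset m := by
          refine axisCurve_mem_Mset h1 ?_
          have := exp_log_two_mul_le ht.2
          nlinarith
        exact ⟨hM, hasDerivAt_axisCurve hM⟩
      · obtain ⟨γ, h0, hγ⟩ := exists_integralCurve_slice hp hz
        exact ⟨γ, by rw [h0, ← hy], fun t ht ↦ hγ t ⟨by linarith [ht.1], by linarith [ht.2]⟩⟩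
    · obtain ⟨γ, h0, hγ⟩ := exists_integralCurve_of_ne_zero hz hy
      exact ⟨γ, h0, fun t ht ↦ hγ t ⟨by linarith [ht.1], by linarith [ht.2]⟩⟩
  · rintro z hz ⟨γ, h0, hγ⟩
    have h1 : (1 : ℝ) ∈ Icc (0 : ℝ) 1 := by norm_num
    have heq := eq_axisCurve (h0.trans (hR1 z hz)) hγ 1 h1
    have hM : (γ 1).2.1 < 1 := (hγ 1 h1).1.2
    rw [heq, axisCurve, hexp1] at hM
    linarith [hz.2.1.1]
  · intro z hz
    by_cases hy : z.2.2 = 0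
    · by_cases hp : z.1 = 0
      · have h1 : -1 < z.2.1 := hz.1
        have h2 : z.2.1 < 1 := hz.2
        refine ⟨axisCurve m z.2.1, by rw [axisCurve_zero, ← hp, ← hy], fun t ht ↦ ?_⟩
        have hM : axisCurve m z.2.1 t ∈ Mset m := by
          refine axisCurve_mem_Mset h1 ?_
          have : Real.exp (Real.log 2 * t) ≤ 1 := by simpa using exp_log_two_mul_le ht.2
          nlinarith
        exact ⟨hM, hasDerivAt_axisCurve hM⟩
      · obtain ⟨γ, h0, hγ⟩ := exists_integralCurve_slice hp hz
        exact ⟨γ, by rw [h0, ← hy], fun t ht ↦ hγ t ⟨by linarith [ht.1], by linarith [ht.2]⟩⟩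
    · obtain ⟨γ, h0, hγ⟩ := exists_integralCurve_of_ne_zero hz hy
      exact ⟨γ, h0, fun t ht ↦ hγ t ⟨by linarith [ht.1], by linarith [ht.2]⟩⟩
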